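/- arXiv:2104.14347 — 2 statements merged into one kernel-verified Lean document; each statement's English description precedes it below -/
import Mathlib

section
/- A picking sequence π on n agents and m items satisfies weighted envy-freeness up to one item (WEF1) — that is, for every profile of additive utility functions the allocation it produces is WEF1 — if and only if for every prefix of π and every pair of agents i, j such that j picks at least twice in the prefix, we have t_i/(t_j − 1) ≥ w_i/w_j, where t_i and t_j denote the number of picks of agents i and j in that prefix. -/
open Finset

/-- The favorite item of an agent with item-utility function `u` among a remaining
set `R` of items: a highest-valued item, ties broken in favor of the lower-numbered item. -/
noncomputable def favorite {m : ℕ} (u : Fin m → ℝ) (R : Finset (Fin m)) : Option (Fin m) :=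
  if h : (R.filter fun j => ∀ j' ∈ R, u j' ≤ u j).Nonempty then
    some ((R.filter fun j => ∀ j' ∈ R, u j' ≤ u j).min' h)
  else none

/-- One step of the picking process: agent `a` picks her favorite remaining item. -/
noncomputable def pickStep {n m : ℕ} (u : Fin n → Fin m → ℝ)
    (st : Finset (Fin m) × (Fin n → Finset (Fin m))) (a : Fin n) :
    Finset (Fin m) × (Fin n → Finset (Fin m)) :=
  match favorite (u a) st.1 with
  | none => st
  | some j => (st.1.erase j, Function.update st.2 a (insert j (st.2 a)))

/-- The allocation produced by letting agents pick their favorite remaining items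
in the order given by the picking sequence `π`. -/
noncomputable def allocate {n m : ℕ} (u : Fin n → Fin m → ℝ) (π : List (Fin n)) :
    Fin n → Finset (Fin m) :=
  (π.foldl (pickStep u) (Finset.univ, fun _ => ∅)).2

/-- Weighted envy-freeness up to one item. -/
def isWEF1 {n m : ℕ} (w : Fin n → ℝ) (u : Fin n → Fin m → ℝ)
    (M : Fin n → Finset (Fin m)) : Prop :=
  ∀ i j : Fin n, ∃ B ⊆ M j, B.card ≤ 1 ∧
    (∑ x ∈ M j \ B, u i x) / w j ≤ (∑ x ∈ M i, u i x) / w i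

theorem pickStep_spec {n m : ℕ} (u : Fin n → Fin m → ℝ) (R : Finset (Fin m))
    (M : Fin n → Finset (Fin m)) (a : Fin n) (hR : R.Nonempty) :
    ∃ x ∈ R, (∀ y ∈ R, u a y ≤ u a x) ∧
      pickStep u (R, M) a = (R.erase x, Function.update M a (insert x (M a))) := by
  have h : (R.filter fun j => ∀ j' ∈ R, u a j' ≤ u a j).Nonempty := by
    obtain ⟨x, hx, hx'⟩ := Finset.exists_max_image R (u a) hR
    exact ⟨x, by simp [hx]; exact hx'⟩
  have hm := Finset.min'_mem _ h
  rw [Finset.mem_filter] at hm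
  refine ⟨_, hm.1, hm.2, ?_⟩
  simp only [pickStep, favorite, dif_pos h]

theorem disj_step {n m : ℕ} {R : Finset (Fin m)} {M : Fin n → Finset (Fin m)}
    (hM : ∀ a, Disjoint (M a) R) (b : Fin n) (x : Fin m) :
    ∀ a, Disjoint (Function.update M b (insert x (M b)) a) (R.erase x) := by
  intro a
  by_cases hab : a = b
  · subst hab
    simp only [Function.update_self, Finset.disjoint_insert_left]
    exact ⟨by simp, (hM a).mono_right (Finset.erase_subset _ _)⟩
  · rw [Function.update_of_ne hab]
    exact (hM a).mono_right (Finset.erase_subset _ _)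

theorem foldl_mono {n m : ℕ} (u : Fin n → Fin m → ℝ) (l : List (Fin n)) :
    ∀ (st : Finset (Fin m) × (Fin n → Finset (Fin m))) (a : Fin n),
      st.2 a ⊆ (l.foldl (pickStep u) st).2 a := by
  induction l with
  | nil => intro st a; simp
  | cons b l ih =>
    intro st a
    refine Finset.Subset.trans ?_ (ih _ a)
    obtain ⟨R, M⟩ := st
    unfold pickStep
    split
    · simp
    · by_cases hab : a = b
      · subst hab; simp
      · simp [Function.update_of_ne hab]

theorem count_lem {n m : ℕ} (k : ℕ) (u : Fin n → Fin m → ℝ)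
    (hu : ∀ a y, u a y = if (y : ℕ) < k then 1 else 0) (a : Fin n) (l : List (Fin n)) :
    ∀ (R : Finset (Fin m)) (M : Fin n → Finset (Fin m)),
      l.length = R.card → (∀ a, Disjoint (M a) R) →
      (((l.foldl (pickStep u) (R, M)).2 a).filter (fun y : Fin m => (y : ℕ) < k)).card =
        ((M a).filter (fun y : Fin m => (y : ℕ) < k)).card +
          (l.take (R.filter (fun y : Fin m => (y : ℕ) < k)).card).count a := by
  induction l with
  | nil => intro R M _ _; simp
  | cons b l ih =>
    intro R M hl hM
    have hR : R.Nonempty := by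
      rw [← Finset.card_pos, ← hl]; simp
    obtain ⟨x, hx, hmax, hst⟩ := pickStep_spec u R M b hR
    rw [List.foldl_cons, hst, ih _ _ (by rw [Finset.card_erase_of_mem hx, ← hl]; simp)
      (disj_step hM b x)]
    have hxM : ∀ c, x ∉ M c := fun c hc => Finset.disjoint_left.mp (hM c) hc hx
    rw [Finset.filter_erase]
    by_cases hxk : (x : ℕ) < k
    · have hxf : x ∈ R.filter (fun y : Fin m => (y : ℕ) < k) := by simp [hx, hxk]
      obtain ⟨q, hq⟩ : ∃ q, (R.filter (fun y : Fin m => (y : ℕ) < k)).card = q + 1 :=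
        Nat.exists_eq_succ_of_ne_zero (Finset.card_ne_zero_of_mem hxf)
      rw [Finset.card_erase_of_mem hxf, hq]
      by_cases hab : a = b
      · subst hab
        rw [Function.update_self, Finset.filter_insert, if_pos hxk,
          Finset.card_insert_of_notMem (by simp [hxM])]
        simp; omega
      · rw [Function.update_of_ne hab]
        simp [List.count_cons, Ne.symm hab]
    · have h0 : R.filter (fun y : Fin m => (y : ℕ) < k) = ∅ := by
        rw [Finset.filter_eq_empty_iff]
        intro y hy hyk
        have := hmax y hy
        rw [hu, hu, if_pos hyk, if_neg hxk] at this
        linarith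
      rw [h0]
      by_cases hab : a = b
      · subst hab
        rw [Function.update_self, Finset.filter_insert, if_neg hxk]
        simp
      · rw [Function.update_of_ne hab]
        simp

theorem main1 {n m : ℕ} (w : Fin n → ℝ) (hw : ∀ i, 0 < w i) (u : Fin n → Fin m → ℝ)
    (i j : Fin n) (hij : i ≠ j) (hu : ∀ y, 0 ≤ u i y) (l : List (Fin n)) :
    ∀ (R : Finset (Fin m)) (M : Fin n → Finset (Fin m)) (S V : ℝ),
      l.length = R.card → (∀ a, Disjoint (M a) R) → 0 ≤ V → (∀ y ∈ R, u i y ≤ V) →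
      (∀ k, 0 ≤ S + ((l.take k).count i : ℝ) / w i - ((l.take k).count j : ℝ) / w j) →
      0 ≤ S * V + (∑ x ∈ (l.foldl (pickStep u) (R, M)).2 i, u i x - ∑ x ∈ M i, u i x) / w i
        - (∑ x ∈ (l.foldl (pickStep u) (R, M)).2 j, u i x - ∑ x ∈ M j, u i x) / w j := by
  induction l with
  | nil =>
    intro R M S V _ _ hV _ hS
    have := hS 0
    simp at this
    simp
    positivity
  | cons b l ih =>
    intro R M S V hl hM hV hRV hS
    have hR : R.Nonempty := by
      rw [← Finset.card_pos, ← hl]; simp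
    have hS0 := hS 0
    simp at hS0
    obtain ⟨x, hx, hmax, hst⟩ := pickStep_spec u R M b hR
    have hxM : ∀ c, x ∉ M c := fun c hc => Finset.disjoint_left.mp (hM c) hc hx
    have hl' : l.length = (R.erase x).card := by
      rw [Finset.card_erase_of_mem hx, ← hl]; simp
    have IH := ih (R.erase x) (Function.update M b (insert x (M b)))
    rw [List.foldl_cons, hst]
    have hwi := hw i
    have hwj := hw j
    by_cases hbi : b = i
    · subst hbi
      have := IH (S + 1 / w b) (u b x) hl' (disj_step hM b x) (hu x)
        (fun y hy => hmax y (Finset.mem_of_mem_erase hy)) (by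
          intro k
          have := hS (k + 1)
          simp [List.count_cons, hij] at this
          rw [add_div] at this
          linarith)
      rw [Function.update_self, Function.update_of_ne hij.symm,
        Finset.sum_insert (hxM b)] at this
      have h1 : S * u b x ≤ S * V := mul_le_mul_of_nonneg_left (hRV x hx) hS0
      have h2 : ∀ A C : ℝ, (A - (u b x + C)) / w b = (A - C) / w b - 1 / w b * u b x := by
        intros; ring
      rw [h2] at this
      nlinarith
    · by_cases hbj : b = j
      · subst hbj
        have := IH (S - 1 / w b) V hl' (disj_step hM b x) hV
          (fun y hy => hRV y (Finset.mem_of_mem_erase hy)) (by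
            intro k
            have := hS (k + 1)
            simp [List.count_cons, hbi] at this
            rw [add_div] at this
            linarith)
        rw [Function.update_self, Function.update_of_ne hij,
          Finset.sum_insert (hxM b)] at this
        have h1 : 1 / w b * u i x ≤ 1 / w b * V :=
          mul_le_mul_of_nonneg_left (hRV x hx) (by positivity)
        have h2 : ∀ A C : ℝ, (A - (u i x + C)) / w b = (A - C) / w b - 1 / w b * u i x := by
          intros; ring
        rw [h2] at this
        nlinarith
      · have := IH S V hl' (disj_step hM b x) hV
          (fun y hy => hRV y (Finset.mem_of_mem_erase hy)) (by
            intro k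
            have := hS (k + 1)
            simpa [List.count_cons, hbi, hbj] using this)
        rwa [Function.update_of_ne (Ne.symm hbi), Function.update_of_ne (Ne.symm hbj)] at this

theorem main2 {n m : ℕ} (w : Fin n → ℝ) (hw : ∀ i, 0 < w i) (u : Fin n → Fin m → ℝ)
    (i j : Fin n) (hij : i ≠ j) (hu : ∀ y, 0 ≤ u i y) (l : List (Fin n)) :
    ∀ (R : Finset (Fin m)) (M : Fin n → Finset (Fin m)) (S V : ℝ),
      l.length = R.card → (∀ a, Disjoint (M a) R) → 0 ≤ V → (∀ y ∈ R, u i y ≤ V) →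
      M j = ∅ → 0 ≤ S →
      (∀ k, 1 ≤ (l.take k).count j →
        0 ≤ S + ((l.take k).count i : ℝ) / w i - (((l.take k).count j : ℝ) - 1) / w j) →
      ∃ B ⊆ (l.foldl (pickStep u) (R, M)).2 j, B.card ≤ 1 ∧
      0 ≤ S * V + (∑ x ∈ (l.foldl (pickStep u) (R, M)).2 i, u i x - ∑ x ∈ M i, u i x) / w i
        - (∑ x ∈ (l.foldl (pickStep u) (R, M)).2 j \ B, u i x) / w j := by
  induction l with
  | nil =>
    intro R M S V _ _ hV _ hMj hS0 hS
    refine ⟨∅, by simp, by simp, ?_⟩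
    simp [hMj]
    positivity
  | cons b l ih =>
    intro R M S V hl hM hV hRV hMj hS0 hS
    have hR : R.Nonempty := by
      rw [← Finset.card_pos, ← hl]; simp
    obtain ⟨x, hx, hmax, hst⟩ := pickStep_spec u R M b hR
    have hxM : ∀ c, x ∉ M c := fun c hc => Finset.disjoint_left.mp (hM c) hc hx
    have hl' : l.length = (R.erase x).card := by
      rw [Finset.card_erase_of_mem hx, ← hl]; simp
    have IH := ih (R.erase x) (Function.update M b (insert x (M b)))
    rw [List.foldl_cons, hst]
    have hwi := hw i
    have hwj := hw j
    by_cases hbi : b = i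
    · subst hbi
      obtain ⟨B, hB, hB1, this⟩ := IH (S + 1 / w b) (u b x) hl' (disj_step hM b x) (hu x)
        (fun y hy => hmax y (Finset.mem_of_mem_erase hy))
        (by rw [Function.update_of_ne hij.symm, hMj]) (by positivity) (by
          intro k hk
          have := hS (k + 1) (by simp [List.count_cons, hij]; simpa using hk)
          simp [List.count_cons, hij] at this
          rw [add_div] at this
          linarith)
      refine ⟨B, hB, hB1, ?_⟩
      rw [Function.update_self, Finset.sum_insert (hxM b)] at this
      have h1 : S * u b x ≤ S * V := mul_le_mul_of_nonneg_left (hRV x hx) hS0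
      have h2 : ∀ A C : ℝ, (A - (u b x + C)) / w b = (A - C) / w b - 1 / w b * u b x := by
        intros; ring
      rw [h2] at this
      nlinarith
    · by_cases hbj : b = j
      · subst hbj
        have hsub := foldl_mono u l (R.erase x, Function.update M b (insert x (M b))) b
        have hxF : {x} ⊆ (l.foldl (pickStep u)
            (R.erase x, Function.update M b (insert x (M b)))).2 b := by
          refine Finset.Subset.trans ?_ hsub
          simp
        refine ⟨{x}, hxF, by simp, ?_⟩
        have := main1 w hw u i b hij hu l (R.erase x) (Function.update M b (insert x (M b)))
          S V hl' (disj_step hM b x) hV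
          (fun y hy => hRV y (Finset.mem_of_mem_erase hy)) (by
            intro k
            have := hS (k + 1) (by simp)
            simp [List.count_cons, hbi] at this
            linarith)
        rw [Function.update_self, Function.update_of_ne hij,
          Finset.sum_insert (hxM b)] at this
        rw [← Finset.sum_sdiff hxF] at this
        simp only [hMj, Finset.sum_singleton, Finset.sum_empty, add_zero,
          add_sub_cancel_right] at this ⊢
        exact this
      · obtain ⟨B, hB, hB1, this⟩ := IH S V hl' (disj_step hM b x) hV
          (fun y hy => hRV y (Finset.mem_of_mem_erase hy))
          (by rw [Function.update_of_ne (Ne.symm hbj), hMj]) hS0 (by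
            intro k hk
            have := hS (k + 1) (by simpa [List.count_cons, hbi, hbj] using hk)
            simpa [List.count_cons, hbi, hbj] using this)
        refine ⟨B, hB, hB1, ?_⟩
        rwa [Function.update_of_ne (Ne.symm hbi)] at this

theorem pickingSequence_WEF1_iff
    (n m : ℕ) (w : Fin n → ℝ) (hw : ∀ i, 0 < w i)
    (π : List (Fin n)) (hlen : π.length = m) :
    (∀ u : Fin n → Fin m → ℝ, (∀ i j, 0 ≤ u i j) → isWEF1 w u (allocate u π)) ↔
      ∀ (k : ℕ), k ≤ m → ∀ (i j : Fin n), 2 ≤ (π.take k).count j →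
        w i / w j ≤ ((π.take k).count i : ℝ) / (((π.take k).count j : ℝ) - 1) := by
  constructor
  · intro h k hk i j hj
    have hwi := hw i
    have hwj := hw j
    obtain ⟨B, hB, hB1, hle⟩ := h (fun _ y => if (y : ℕ) < k then 1 else 0)
      (by intro i j; positivity) i j
    have hc : ∀ a, (((allocate (fun _ y => if (y : ℕ) < k then (1 : ℝ) else 0) π) a).filter
        (fun y : Fin m => (y : ℕ) < k)).card = (π.take k).count a := by
      intro a
      have := count_lem k (fun (_ : Fin n) (y : Fin m) => if (y : ℕ) < k then (1 : ℝ) else 0)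
        (fun _ _ => rfl) a π Finset.univ (fun _ => ∅) (by simp [hlen]) (by simp)
      rw [allocate, this]
      have : (Finset.univ.filter (fun y : Fin m => (y : ℕ) < k)).card = k := by
        rw [Fin.card_filter_val_lt]; omega
      simp [this]
    have hj2 : (2 : ℝ) ≤ ((π.take k).count j : ℝ) := by exact_mod_cast hj
    have key : ((π.take k).count j : ℝ) - 1 ≤
        ∑ x ∈ allocate (fun _ y => if (y : ℕ) < k then (1 : ℝ) else 0) π j \ B,
          (if (x : ℕ) < k then (1 : ℝ) else 0) := by
      have h1 := Finset.sum_sdiff hB (f := fun x : Fin m => if (x : ℕ) < k then (1 : ℝ) else 0)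
      have h2 : ∑ x ∈ B, (if (x : ℕ) < k then (1 : ℝ) else 0) ≤ ∑ x ∈ B, 1 :=
        Finset.sum_le_sum (fun x _ => by split <;> norm_num)
      have h3 : (B.card : ℝ) ≤ 1 := by exact_mod_cast hB1
      have h4 := hc j
      rw [← h4]
      have h6 := Finset.sum_boole (R := ℝ) (fun y : Fin m => (y : ℕ) < k)
        (allocate (fun _ y => if (y : ℕ) < k then (1 : ℝ) else 0) π j)
      rw [Finset.sum_const, nsmul_eq_mul, mul_one] at h2
      rw [h6] at h1
      linarith
    have e : ∑ x ∈ allocate (fun _ (y : Fin m) => if (y : ℕ) < k then (1 : ℝ) else 0) π i,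
          (if (x : ℕ) < k then (1 : ℝ) else 0) = ((π.take k).count i : ℝ) := by
      rw [Finset.sum_boole, hc i]
    have h5 : (((π.take k).count j : ℝ) - 1) / w j ≤ ((π.take k).count i : ℝ) / w i := by
      rw [← e]
      exact (div_le_div_of_nonneg_right key hwj.le).trans hle
    rw [div_le_div_iff₀ hwj hwi] at h5
    rw [div_le_div_iff₀ hwj (by linarith)]
    linarith
  · intro h u hu i j
    have hwi := hw i
    have hwj := hw j
    by_cases hij : i = j
    · subst hij
      exact ⟨∅, by simp, by simp, by simp⟩
    · obtain ⟨B, hB, hB1, hle⟩ := main2 w hw u i j hij (hu i) π Finset.univ (fun _ => ∅) 0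
        (∑ y, u i y) (by simp [hlen]) (by simp) (Finset.sum_nonneg (fun y _ => hu i y))
        (fun y _ => Finset.single_le_sum (fun z _ => hu i z) (Finset.mem_univ y)) rfl le_rfl (by
          intro k hk
          rcases Nat.lt_or_ge ((π.take k).count j) 2 with h2 | h2
          · have : (π.take k).count j = 1 := by omega
            rw [this]
            simp
            positivity
          · have h2' : (2 : ℝ) ≤ ((π.take k).count j : ℝ) := by exact_mod_cast h2
            have hmk : π.take (min k m) = π.take k := by
              rw [← hlen]
              rcases le_total k π.length with hk | hk
              · rw [min_eq_left hk]
              · rw [min_eq_right hk, List.take_of_length_le hk, List.take_length]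
            have := h (min k m) (min_le_right _ _) i j (by rw [hmk]; exact h2)
            rw [hmk, div_le_div_iff₀ hwj (by linarith)] at this
            rw [zero_add, sub_nonneg, div_le_div_iff₀ hwj hwi]
            linarith)
      refine ⟨B, hB, hB1, ?_⟩
      simp only [zero_mul, zero_add, Finset.sum_empty, sub_zero] at hle
      exact sub_nonneg.mp hle
end

section
/- The quota method fails weighted envy-freeness up to one item (WEF1) — there exists an instance (agents with weights and additive utilities) for which the allocation it produces is not WEF1 — but it satisfies weak weighted envy-freeness up to one item (WWEF1) and weighted proportionality up to one item (WPROP1): for every instance, the allocation produced by the quota method is WWEF1 and WPROP1. -/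
open Finset

/-- Weak weighted envy-freeness up to one item. -/
def isWWEF1 {n m : ℕ} (w : Fin n → ℝ) (u : Fin n → Fin m → ℝ)
    (M : Fin n → Finset (Fin m)) : Prop :=
  ∀ i j : Fin n, ∃ B ⊆ M j, B.card ≤ 1 ∧
    ((∑ x ∈ M j \ B, u i x) / w j ≤ (∑ x ∈ M i, u i x) / w i ∨
     (∑ x ∈ M j, u i x) / w j ≤ (∑ x ∈ M i ∪ B, u i x) / w i)

/-- Weighted proportionality up to one item. -/
def isWPROP1 {n m : ℕ} (w : Fin n → ℝ) (u : Fin n → Fin m → ℝ)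
    (M : Fin n → Finset (Fin m)) : Prop :=
  ∀ i : Fin n, ∃ B ⊆ Finset.univ \ M i, B.card ≤ 1 ∧
    w i / (∑ i', w i') * (∑ x, u i x) - (∑ x ∈ B, u i x) ≤ ∑ x ∈ M i, u i x

/-- `π` is the picking sequence induced by the quota method with weights `w`:
in round `k+1` (0-indexed position `k`), among the eligible agents
(those with `t_i < w_i·(k+1)/Σ w`), the pick goes to an agent minimizing
`(t_i + 1)/w_i`, ties broken toward lower-numbered agents. -/
def IsQuotaSeq {n : ℕ} (w : Fin n → ℝ) (π : List (Fin n)) : Prop :=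
  ∀ (k : ℕ) (hk : k < π.length),
    (((π.take k).count (π.get ⟨k, hk⟩) : ℝ) <
        w (π.get ⟨k, hk⟩) * (k + 1) / ∑ i', w i') ∧
    ∀ i : Fin n, ((π.take k).count i : ℝ) < w i * (k + 1) / ∑ i', w i' →
      (((π.take k).count (π.get ⟨k, hk⟩) : ℝ) + 1) / w (π.get ⟨k, hk⟩) ≤
          (((π.take k).count i : ℝ) + 1) / w i ∧
      (i < π.get ⟨k, hk⟩ →
        (((π.take k).count (π.get ⟨k, hk⟩) : ℝ) + 1) / w (π.get ⟨k, hk⟩) <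
          (((π.take k).count i : ℝ) + 1) / w i)

lemma favorite_spec {m : ℕ} (u : Fin m → ℝ) (R : Finset (Fin m)) (hR : R.Nonempty) :
    ∃ j ∈ R, favorite u R = some j ∧ ∀ j' ∈ R, u j' ≤ u j := by
  have h : (R.filter fun j => ∀ j' ∈ R, u j' ≤ u j).Nonempty := by
    obtain ⟨j, hj, hj'⟩ := Finset.exists_max_image R u hR
    exact ⟨j, by simpa using ⟨hj, hj'⟩⟩
  have hm := Finset.min'_mem _ h
  rw [Finset.mem_filter] at hm
  refine ⟨_, hm.1, ?_, hm.2⟩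
  simp only [favorite, dif_pos h]

lemma struct_aux {n m : ℕ} (u : Fin n → Fin m → ℝ) : ∀ (π : List (Fin n))
    (st : Finset (Fin m) × (Fin n → Finset (Fin m))), π.length = st.1.card →
    ∃ x : Fin π.length → Fin m, Function.Injective x ∧ (∀ k, x k ∈ st.1) ∧
      (∀ a, (π.foldl (pickStep u) st).2 a = st.2 a ∪ (univ.filter fun k => π.get k = a).image x) ∧
      ∀ k l, k ≤ l → u (π.get k) (x l) ≤ u (π.get k) (x k) := by
  intro π
  induction π with
  | nil =>
    intro st _
    refine ⟨fun k => k.elim0, fun k => k.elim0, fun k => k.elim0, ?_, fun k => k.elim0⟩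
    intro a
    simp
  | cons a π ih =>
    intro st hst
    have hne : st.1.Nonempty := by
      rw [← Finset.card_pos, ← hst]; simp
    obtain ⟨j, hj, hf, hmax⟩ := favorite_spec (u a) st.1 hne
    have hstep : pickStep u st a = (st.1.erase j, Function.update st.2 a (insert j (st.2 a))) := by
      simp only [pickStep, hf]
    obtain ⟨x, hinj, hmem, hM, hmon⟩ := ih (pickStep u st a) (by
      rw [hstep]; simp [Finset.card_erase_of_mem hj, ← hst])
    rw [hstep] at hmem
    simp only [Finset.mem_erase] at hmem
    refine ⟨Fin.cons j x, ?_, ?_, ?_, ?_⟩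
    · rw [Fin.cons_injective_iff]
      refine ⟨?_, hinj⟩
      rintro ⟨k, hk⟩
      exact (hmem k).1 hk
    · intro k
      refine Fin.cases ?_ (fun k => ?_) k
      · simpa using hj
      · simpa using (hmem k).2
    · intro a'
      rw [List.foldl_cons, hM a', hstep]
      ext y
      simp only [Finset.mem_union, Finset.mem_image, Finset.mem_filter, Finset.mem_univ, true_and]
      have e : (∃ k : Fin (a :: π).length, (a :: π).get k = a' ∧ (Fin.cons j x : Fin (π.length+1) → Fin m) k = y) ↔
          ((a = a' ∧ j = y) ∨ ∃ k : Fin π.length, π.get k = a' ∧ x k = y) := by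
        change (∃ k : Fin (π.length + 1), _) ↔ _
        rw [Fin.exists_fin_succ]
        rfl
      rw [e]
      by_cases h : a' = a
      · subst h
        simp [eq_comm]
        tauto
      · simp [h, Ne.symm h]
    · intro k
      refine Fin.cases ?_ (fun k => ?_) k
      · intro l _
        refine Fin.cases ?_ (fun l => ?_) l
        · exact le_refl _
        · exact hmax _ (hmem l).2
      · intro l
        refine Fin.cases ?_ (fun l => ?_) l
        · intro h
          exact absurd h (by simp [Fin.le_def])
        · intro h
          exact hmon k l (Fin.succ_le_succ_iff.mp h)

lemma struct {n : ℕ} (π : List (Fin n)) (u : Fin n → Fin π.length → ℝ) :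
    ∃ x : Fin π.length → Fin π.length, Function.Bijective x ∧
      (∀ a, allocate u π a = (univ.filter fun k => π.get k = a).image x) ∧
      ∀ k l, k ≤ l → u (π.get k) (x l) ≤ u (π.get k) (x k) := by
  obtain ⟨x, h1, _, h3, h4⟩ := struct_aux u π (Finset.univ, fun _ => ∅) (by simp)
  refine ⟨x, Finite.injective_iff_bijective.mp h1, ?_, h4⟩
  intro a
  rw [allocate, h3 a]
  simp

lemma abel (n : ℕ) (c v : ℕ → ℝ) (C : ℝ) (hv : Antitone v)
    (hS : ∀ k ≤ n, -C ≤ ∑ l ∈ range k, c l) :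
    ((∑ l ∈ range n, c l) + C) * v n - C * v 0 ≤ ∑ l ∈ range n, c l * v l := by
  induction n with
  | zero => simp
  | succ n ih =>
    have h1 := ih (fun k hk => hS k (by omega))
    have h2 := hS (n+1) le_rfl
    have h3 : v (n+1) ≤ v n := hv (by omega)
    rw [Finset.sum_range_succ] at h2 ⊢
    rw [Finset.sum_range_succ]
    nlinarith

lemma key (m : ℕ) (g c : ℕ → ℝ) (b C : ℝ) (hb : 0 ≤ b) (hC : 0 ≤ C) (hg : ∀ k, 0 ≤ g k)
    (hS : ∀ k ≤ m, -C ≤ ∑ l ∈ range k, c l)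
    (hc : ∀ k < m, (0 ≤ c k ∧ ∀ l, k ≤ l → l < m → g l ≤ g k) ∨ (c k ≤ 0 ∧ g k ≤ b) ∨ c k = 0) :
    -C * b ≤ ∑ k ∈ range m, c k * g k := by
  have hne : (range (m+1)).Nonempty := ⟨0, by simp⟩
  set v : ℕ → ℝ := fun k => (range (m+1)).sup' hne (fun l => if k ≤ l ∧ l < m then g l else 0) with hvdef
  have hanti : Antitone v := by
    intro k k' hk
    refine Finset.sup'_le _ _ (fun l hl => ?_)
    refine le_trans ?_ (Finset.le_sup' _ hl)
    split_ifs with h1 h2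
    · exact le_rfl
    · exact absurd ⟨hk.trans h1.1, h1.2⟩ h2
    · exact hg l
    · exact le_rfl
  have hv0 : ∀ k, 0 ≤ v k := by
    intro k
    refine le_trans ?_ (Finset.le_sup' _ (show 0 ∈ range (m+1) by simp))
    split_ifs
    · exact hg 0
    · exact le_rfl
  have hvg : ∀ k < m, g k ≤ v k := by
    intro k hk
    refine le_trans ?_ (Finset.le_sup' _ (show k ∈ range (m+1) by simp; omega))
    simp [hk]
  have hA := abel m c (fun k => min b (v k)) C (fun k k' hk => min_le_min le_rfl (hanti hk)) hS
  have h1 : 0 ≤ ((∑ l ∈ range m, c l) + C) * min b (v m) :=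
    mul_nonneg (by linarith [hS m le_rfl]) (le_min hb (hv0 m))
  have h2 : C * min b (v 0) ≤ C * b := mul_le_mul_of_nonneg_left (min_le_left _ _) hC
  have h3 : ∑ l ∈ range m, c l * min b (v l) ≤ ∑ k ∈ range m, c k * g k := by
    refine Finset.sum_le_sum (fun k hk => ?_)
    rw [Finset.mem_range] at hk
    rcases hc k hk with ⟨h, h'⟩ | ⟨h, h'⟩ | h
    · refine mul_le_mul_of_nonneg_left (le_trans (min_le_right _ _) ?_) h
      refine Finset.sup'_le _ _ (fun l hl => ?_)
      split_ifs with hh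
      · exact h' l hh.1 hh.2
      · exact hg k
    · exact mul_le_mul_of_nonpos_left (le_min h' (hvg k hk)) h
    · simp [h]
  linarith

lemma exists_B {m : ℕ} (S : Finset (Fin m)) (u : Fin m → ℝ) :
    ∃ B ⊆ S, B.card ≤ 1 ∧ ∀ x ∈ S, u x ≤ ∑ y ∈ B, u y := by
  rcases S.eq_empty_or_nonempty with h | h
  · exact ⟨∅, by simp, by simp, by simp [h]⟩
  · obtain ⟨j, hj, hj'⟩ := Finset.exists_max_image S u h
    exact ⟨{j}, by simpa using hj, by simp, by simpa using hj'⟩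

lemma count_take_succ {n : ℕ} (π : List (Fin n)) (a : Fin n) (k : ℕ) (hk : k < π.length) :
    (π.take (k+1)).count a = (π.take k).count a + if π.get ⟨k, hk⟩ = a then 1 else 0 := by
  rw [List.take_succ_eq_append_getElem hk, List.count_append]
  simp [List.count_singleton]

lemma count_mono {n : ℕ} (π : List (Fin n)) (a : Fin n) {k l : ℕ} (h : k ≤ l) :
    (π.take k).count a ≤ (π.take l).count a :=
  (List.take_sublist_take_left h).count_le a

lemma count_sum {n : ℕ} (π : List (Fin n)) (k : ℕ) (hk : k ≤ π.length) :
    ∑ a, ((π.take k).count a : ℝ) = k := by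
  induction k with
  | zero => simp
  | succ k ih =>
    have := ih (by omega)
    simp only [count_take_succ π _ k hk]
    push_cast
    rw [Finset.sum_add_distrib, this]
    simp

/-- indicator of the pick at position `k` belonging to `a` -/
noncomputable def ind {n : ℕ} (π : List (Fin n)) (a : Fin n) (k : ℕ) : ℝ :=
  if π[k]? = some a then 1 else 0

lemma ind_fin {n : ℕ} (π : List (Fin n)) (a : Fin n) (k : ℕ) (hk : k < π.length) :
    ind π a k = if π.get ⟨k, hk⟩ = a then 1 else 0 := by
  simp [ind, hk]

lemma sum_ind {n : ℕ} (π : List (Fin n)) (a : Fin n) (k : ℕ) (hk : k ≤ π.length) :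
    ∑ l ∈ range k, ind π a l = ((π.take k).count a : ℝ) := by
  induction k with
  | zero => simp
  | succ k ih =>
    rw [Finset.sum_range_succ, ih (by omega), count_take_succ π a k hk, ind_fin π a k hk]
    push_cast
    rfl

/-- Pairwise bound. -/
lemma pair_bound {n : ℕ} (w : Fin n → ℝ) (hw : ∀ i, 0 < w i) (π : List (Fin n))
    (hπ : IsQuotaSeq w π) (i j : Fin n) (C : ℝ) (hC : C = max (1 / w i) (1 / w j)) :
    ∀ k ≤ π.length, ((π.take k).count j : ℝ) / w j - C ≤ ((π.take k).count i : ℝ) / w i := by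
  have hi := hw i
  have hj := hw j
  have hC1 : 1 / w i ≤ C := hC ▸ le_max_left _ _
  have hC2 : 1 / w j ≤ C := hC ▸ le_max_right _ _
  have hCi : C = 1 / w i ∨ C = 1 / w j := by rw [hC]; exact max_choice _ _
  have hC0 : 0 < 1 / w i := by positivity
  intro k
  induction k with
  | zero => intro _; simp; exact le_trans (by positivity) hC1
  | succ k ih =>
    intro hk
    have ih := ih (by omega)
    have hmono : ((π.take k).count i : ℝ) / w i ≤ ((π.take (k+1)).count i : ℝ) / w i := by
      have := count_mono π i (show k ≤ k+1 by omega)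
      gcongr
    by_cases hp : π.get ⟨k, hk⟩ = j
    · obtain ⟨h1, h2⟩ := hπ k hk
      rw [hp] at h1 h2
      have h2 := h2 i
      refine le_trans ?_ hmono
      rw [count_take_succ π j k hk, if_pos hp]
      push_cast
      by_cases he : ((π.take k).count i : ℝ) < w i * (k + 1) / ∑ i', w i'
      · have h3 := (h2 he).1
        rw [add_div _ _ (w i)] at h3
        linarith
      · push Not at he
        have h4 : ((k:ℝ) + 1) / ∑ i', w i' ≤ ((π.take k).count i : ℝ) / w i := by
          rw [le_div_iff₀ hi]
          calc _ = w i * (k + 1) / ∑ i', w i' := by ring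
            _ ≤ _ := he
        have h5 : ((π.take k).count j : ℝ) / w j ≤ ((k:ℝ) + 1) / ∑ i', w i' := by
          rw [div_le_iff₀ hj]
          calc _ ≤ w j * (k + 1) / ∑ i', w i' := h1.le
            _ = _ := by ring
        rw [add_div]
        linarith
    · rw [count_take_succ π j k hk, if_neg hp, add_zero]
      linarith

/-- Lower quota. -/
lemma lower_quota {n : ℕ} (w : Fin n → ℝ) (hw : ∀ i, 0 < w i) (π : List (Fin n))
    (hπ : IsQuotaSeq w π) (i : Fin n) (k : ℕ) (hk : k ≤ π.length) :
    w i / (∑ i', w i') * k - 1 ≤ ((π.take k).count i : ℝ) := by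
  by_contra hcon
  push Not at hcon
  have hW : 0 < ∑ i', w i' := Finset.sum_pos (fun a _ => hw a) ⟨i, mem_univ i⟩
  set W := ∑ i', w i' with hWd
  have hq : ∑ a, w a / W = 1 := by rw [← Finset.sum_div]; exact div_self hW.ne'
  have hq0 : ∀ a, 0 < w a / W := fun a => div_pos (hw a) hW
  -- core contradiction
  have core : ∀ l ≤ k,
      (∀ r (hr : r < π.length), l ≤ r → r < k →
        ((π.take (r+1)).count (π.get ⟨r, hr⟩) : ℝ) ≤ w (π.get ⟨r, hr⟩) / W * k) →
      (∀ a, w a / W * l ≤ ((π.take l).count a : ℝ) ∨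
        w a / W * k < ((π.take l).count a : ℝ) + 1) → False := by
    intro l hl hgood hopt
    have hinv : ∀ a, ∀ r, l ≤ r → r ≤ k → (π.take r).count a = (π.take l).count a ∨
        ((π.take r).count a : ℝ) ≤ w a / W * k := by
      intro a r hlr
      induction r, hlr using Nat.le_induction with
      | base => intro _; exact Or.inl rfl
      | succ r hlr ih =>
        intro hrk
        have hr : r < π.length := by omega
        by_cases hp : π.get ⟨r, hr⟩ = a
        · right
          have := hgood r hr hlr (by omega)
          rwa [hp] at this
        · rw [count_take_succ π a r hr, if_neg hp, add_zero]
          exact ih (by omega)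
    have hlk : (l:ℝ) ≤ k := by exact_mod_cast hl
    have hle : ∀ a, ((π.take k).count a : ℝ) - (π.take l).count a ≤ w a / W * (k - l) := by
      intro a
      have hnn : 0 ≤ w a / W * ((k:ℝ) - l) := mul_nonneg (hq0 a).le (by linarith)
      rcases hinv a k hl le_rfl with h | h
      · rw [h]; linarith
      · rcases hopt a with h' | h'
        · linarith
        · have h3 : ((π.take k).count a : ℝ) < (π.take l).count a + 1 := by linarith
          have h4 : (π.take k).count a < (π.take l).count a + 1 := by exact_mod_cast h3
          have h5 : ((π.take k).count a : ℝ) ≤ (π.take l).count a := by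
            exact_mod_cast (by omega : (π.take k).count a ≤ (π.take l).count a)
          linarith
    have hlt : ((π.take k).count i : ℝ) - (π.take l).count i < w i / W * (k - l) := by
      have hm : ((π.take l).count i : ℝ) ≤ (π.take k).count i := by
        exact_mod_cast count_mono π i hl
      rcases hopt i with h' | h'
      · linarith
      · linarith
    have hs := Finset.sum_lt_sum (fun a _ => hle a) ⟨i, mem_univ i, hlt⟩
    rw [Finset.sum_sub_distrib, count_sum π k hk, count_sum π l (by omega), ← Finset.sum_mul, hq] at hs
    linarith
  have down : ∀ d, ∀ l, l + d = k → ∀ r (hr : r < π.length), l ≤ r → r < k →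
        ((π.take (r+1)).count (π.get ⟨r, hr⟩) : ℝ) ≤ w (π.get ⟨r, hr⟩) / W * k := by
    intro d
    induction d with
    | zero => intro l hl r hr h1 h2; omega
    | succ d ih =>
      intro l hl r hr h1 h2
      rcases h1.eq_or_lt with h1 | h1
      · subst h1
        by_contra hc
        push Not at hc
        refine core (l+1) (by omega) (ih (l+1) (by omega)) ?_
        intro a
        by_contra hno
        push Not at hno
        obtain ⟨hn1, hn2⟩ := hno
        have hm : ((π.take l).count a : ℝ) ≤ (π.take (l+1)).count a := by
          exact_mod_cast count_mono π a (by omega)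
        have hel : ((π.take l).count a : ℝ) < w a * (l + 1) / W := by
          have : w a * (l + 1) / W = w a / W * ((l+1 : ℕ) : ℝ) := by push_cast; ring
          rw [this]; linarith
        have h3 := ((hπ l hr).2 a hel).1
        rw [count_take_succ π _ l hr, if_pos rfl] at hc
        push_cast at hc
        have h4 : (k:ℝ) / W < (((π.take l).count (π.get ⟨l, hr⟩) : ℝ) + 1) / w (π.get ⟨l, hr⟩) := by
          rw [lt_div_iff₀ (hw _)]
          calc _ = w (π.get ⟨l, hr⟩) / W * k := by ring
            _ < _ := hc
        have h5 : (((π.take l).count a : ℝ) + 1) / w a ≤ (k:ℝ) / W := by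
          rw [div_le_iff₀ (hw a)]
          calc _ ≤ w a / W * k := by linarith
            _ = _ := by ring
        linarith
      · exact ih (l+1) (by omega) r hr h1 h2
  exact core 0 (by omega) (down k 0 (by omega)) (fun a => Or.inl (by simp))

lemma fails : ∃ (n m : ℕ) (w : Fin n → ℝ) (u : Fin n → Fin m → ℝ) (π : List (Fin n)),
       (∀ i, 0 < w i) ∧ (∀ i j, 0 ≤ u i j) ∧ π.length = m ∧ IsQuotaSeq w π ∧
       ¬ isWEF1 w u (allocate u π) := by
  refine ⟨2, ([1, 1] : List (Fin 2)).length, ![1, 3], fun _ _ => 1, [1, 1], ?_, ?_, rfl, ?_, ?_⟩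
  · intro i; fin_cases i <;> norm_num
  · intro i j; norm_num
  · intro k hk
    have : k < 2 := by simpa using hk
    interval_cases k
    · refine ⟨by norm_num, fun i => ?_⟩
      fin_cases i <;> norm_num
    · refine ⟨by norm_num, fun i => ?_⟩
      fin_cases i <;> norm_num
  · intro h
    obtain ⟨x, hx, hM, _⟩ := struct ([1, 1] : List (Fin 2)) (fun _ _ => 1)
    have hg : ∀ k : Fin ([1, 1] : List (Fin 2)).length, ([1, 1] : List (Fin 2)).get k = 1 := by decide
    obtain ⟨B, hB, hc, hle⟩ := h 0 1
    have h0 := hM 0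
    have h1 := hM 1
    simp only [hg] at h0 h1
    rw [h0, h1] at hle
    rw [h1] at hB
    simp only [Finset.filter_true, Finset.image_univ_of_surjective hx.2] at hle hB
    have hcard := Finset.card_sdiff_add_card_eq_card hB
    rw [Finset.card_univ, Fintype.card_fin] at hcard
    simp at hle hcard
    have hz : (univ \ B).card = 0 := by
      have h3 : ((univ \ B).card : ℝ) ≤ 0 := by
        by_contra hh
        push Not at hh
        linarith
      exact Nat.le_zero.mp (by exact_mod_cast h3)
    omega

lemma sat {n : ℕ} (w : Fin n → ℝ) (hw : ∀ i, 0 < w i) (π : List (Fin n)) (hπ : IsQuotaSeq w π)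
    (u : Fin n → Fin π.length → ℝ) (hu : ∀ i j, 0 ≤ u i j) :
    isWWEF1 w u (allocate u π) ∧ isWPROP1 w u (allocate u π) := by
  obtain ⟨x, hx, hM, hmon⟩ := struct π u
  set M := allocate u π with hMd
  let g : Fin n → ℕ → ℝ := fun i k => if h : k < π.length then u i (x ⟨k, h⟩) else 0
  have hg0 : ∀ i k, 0 ≤ g i k := by
    intro i k
    by_cases h : k < π.length
    · simp [g, h, hu]
    · simp [g, h]
  have hgk : ∀ i k (h : k < π.length), g i k = u i (x ⟨k, h⟩) := fun i k h => by simp [g, h]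
  have hmem : ∀ a k, x k ∈ M a ↔ π.get k = a := by
    intro a k
    rw [hM a]
    simp only [Finset.mem_image, Finset.mem_filter, Finset.mem_univ, true_and]
    constructor
    · rintro ⟨k', h1, h2⟩
      rw [← hx.1 h2]; exact h1
    · intro h; exact ⟨k, h, rfl⟩
  have hsum : ∀ i a, ∑ y ∈ M a, u i y = ∑ k ∈ range π.length, ind π a k * g i k := by
    intro i a
    rw [hM a, Finset.sum_image (fun _ _ _ _ h => hx.1 h), Finset.sum_filter, Finset.sum_range]
    refine Finset.sum_congr rfl (fun k _ => ?_)
    rw [ind_fin π a k k.2, hgk i k k.2]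
    simp
  have hall : ∀ i, ∑ y, u i y = ∑ k ∈ range π.length, g i k := by
    intro i
    rw [← hx.sum_comp, Finset.sum_range]
    exact Finset.sum_congr rfl (fun k _ => (hgk i k k.2).symm)
  have hown : ∀ i k (hk : k < π.length), π.get ⟨k, hk⟩ = i → ∀ l, k ≤ l → l < π.length →
      g i l ≤ g i k := by
    intro i k hk hp l hkl hl
    rw [hgk i k hk, hgk i l hl]
    have := hmon ⟨k, hk⟩ ⟨l, hl⟩ hkl
    rwa [hp] at this
  constructor
  · intro i j
    by_cases hij : i = j
    · subst hij
      exact ⟨∅, by simp, by simp, Or.inl (by simp)⟩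
    obtain ⟨B, hBs, hBc, hB⟩ := exists_B (M j) (u i)
    refine ⟨B, hBs, hBc, ?_⟩
    have hb : 0 ≤ ∑ y ∈ B, u i y := Finset.sum_nonneg (fun y _ => hu i y)
    have hi := hw i
    have hj := hw j
    have hC0 : 0 ≤ max (1 / w i) (1 / w j) := le_max_of_le_left (by positivity)
    have hk := key π.length (g i) (fun k => ind π i k / w i - ind π j k / w j) (∑ y ∈ B, u i y)
      (max (1 / w i) (1 / w j)) hb hC0 (hg0 i) (by
        intro k hk
        rw [Finset.sum_sub_distrib, ← Finset.sum_div, ← Finset.sum_div, sum_ind π i k hk,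
          sum_ind π j k hk]
        linarith [pair_bound w hw π hπ i j _ rfl k hk]) (by
        intro k hk
        rw [ind_fin π i k hk, ind_fin π j k hk]
        by_cases h1 : π.get ⟨k, hk⟩ = i
        · left
          rw [if_pos h1, if_neg (by rw [h1]; exact hij)]
          exact ⟨by simp; exact hi.le, hown i k hk h1⟩
        · right
          rw [if_neg h1]
          by_cases h2 : π.get ⟨k, hk⟩ = j
          · left
            rw [if_pos h2]
            refine ⟨by simp; exact hj.le, ?_⟩
            rw [hgk i k hk]
            exact hB _ ((hmem j _).2 h2)
          · right
            rw [if_neg h2]; simp)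
    have e : ∑ k ∈ range π.length, (ind π i k / w i - ind π j k / w j) * g i k =
        (∑ y ∈ M i, u i y) / w i - (∑ y ∈ M j, u i y) / w j := by
      rw [hsum i i, hsum i j, Finset.sum_div, Finset.sum_div, ← Finset.sum_sub_distrib]
      exact Finset.sum_congr rfl (fun k _ => by ring)
    rw [e] at hk
    rcases max_choice (1 / w i) (1 / w j) with hc | hc
    · right
      rw [hc] at hk
      have hd : Disjoint (M i) B := by
        rw [Finset.disjoint_left]
        intro y hy hyB
        obtain ⟨k, rfl⟩ := hx.2 y
        exact hij (((hmem i k).1 hy).symm.trans ((hmem j k).1 (hBs hyB)))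
      rw [Finset.sum_union hd, add_div]
      have : -(1 / w i) * ∑ y ∈ B, u i y = -((∑ y ∈ B, u i y) / w i) := by ring
      linarith
    · left
      rw [hc] at hk
      have h1 := Finset.sum_sdiff (f := u i) hBs
      have h2 : ∑ y ∈ M j \ B, u i y = ∑ y ∈ M j, u i y - ∑ y ∈ B, u i y := by linarith
      rw [h2, sub_div]
      have : -(1 / w j) * ∑ y ∈ B, u i y = -((∑ y ∈ B, u i y) / w j) := by ring
      linarith
  · intro i
    obtain ⟨B, hBs, hBc, hB⟩ := exists_B (univ \ M i) (u i)
    refine ⟨B, hBs, hBc, ?_⟩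
    have hb : 0 ≤ ∑ y ∈ B, u i y := Finset.sum_nonneg (fun y _ => hu i y)
    have hW : 0 < ∑ i', w i' := Finset.sum_pos (fun a _ => hw a) ⟨i, mem_univ i⟩
    have ha0 : 0 ≤ w i / ∑ i', w i' := (div_pos (hw i) hW).le
    have ha1 : w i / ∑ i', w i' ≤ 1 := by
      rw [div_le_one hW]
      exact Finset.single_le_sum (fun a _ => (hw a).le) (mem_univ i)
    have hk := key π.length (g i) (fun k => ind π i k - w i / ∑ i', w i') (∑ y ∈ B, u i y)
      1 hb zero_le_one (hg0 i) (by
        intro k hk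
        rw [Finset.sum_sub_distrib, sum_ind π i k hk]
        have := lower_quota w hw π hπ i k hk
        simp only [Finset.sum_const, Finset.card_range, nsmul_eq_mul]
        linarith) (by
        intro k hk
        rw [ind_fin π i k hk]
        by_cases h1 : π.get ⟨k, hk⟩ = i
        · left
          rw [if_pos h1]
          exact ⟨by linarith, hown i k hk h1⟩
        · right; left
          rw [if_neg h1]
          refine ⟨by linarith, ?_⟩
          rw [hgk i k hk]
          refine hB _ ?_
          simp only [Finset.mem_sdiff, Finset.mem_univ, true_and]
          rwa [hmem])
    have e : ∑ k ∈ range π.length, (ind π i k - w i / ∑ i', w i') * g i k =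
        (∑ y ∈ M i, u i y) - w i / (∑ i', w i') * ∑ y, u i y := by
      rw [hsum i i, hall i, Finset.mul_sum, ← Finset.sum_sub_distrib]
      exact Finset.sum_congr rfl (fun k _ => by ring)
    rw [e] at hk
    linarith

/-- The quota method fails WEF1 — there is an instance for which the
allocation it produces is not WEF1 — but it satisfies WWEF1 and WPROP1: for every
instance, the allocation produced by the quota method is WWEF1 and WPROP1. -/
theorem quota_fairness :
    (∃ (n m : ℕ) (w : Fin n → ℝ) (u : Fin n → Fin m → ℝ) (π : List (Fin n)),
       (∀ i, 0 < w i) ∧ (∀ i j, 0 ≤ u i j) ∧ π.length = m ∧ IsQuotaSeq w π ∧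
       ¬ isWEF1 w u (allocate u π)) ∧
    (∀ (n m : ℕ) (w : Fin n → ℝ), (∀ i, 0 < w i) →
      ∀ π : List (Fin n), π.length = m → IsQuotaSeq w π →
      ∀ u : Fin n → Fin m → ℝ, (∀ i j, 0 ≤ u i j) →
        isWWEF1 w u (allocate u π) ∧ isWPROP1 w u (allocate u π)) := by
  refine ⟨fails, ?_⟩
  intro n m w hw π hm hπ u hu
  subst hm
  exact sat w hw π hπ u hu
end
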